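/- In the braid group B_6, the braids δ_4 β_4 and β_4 δ_4 are M-equivalent relative to the tuple ρ^6(3) = ((1 2),(1 2),(2 3),(2 3),(2 3),(2 3)) of transpositions of S_3; that is, δ_4 commutes with β_4 modulo the move M. -/

import Mathlib

open Equiv

/-- The braid relations on generators `β_0, …, β_{n-2}` (indexed by `Fin (n-1)`). -/
def braidRels (n : ℕ) : Set (FreeGroup (Fin (n - 1))) :=
  {r | (∃ i j : Fin (n - 1), (i : ℕ) + 2 ≤ (j : ℕ) ∧
          r = FreeGroup.of i * FreeGroup.of j * (FreeGroup.of i)⁻¹ * (FreeGroup.of j)⁻¹) ∨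
       (∃ i j : Fin (n - 1), (i : ℕ) + 1 = (j : ℕ) ∧
          r = FreeGroup.of i * FreeGroup.of j * FreeGroup.of i *
              (FreeGroup.of j * FreeGroup.of i * FreeGroup.of j)⁻¹)}

/-- The braid group `B_n` on `n` strands, presented by the Artin generators and relations. -/
def BraidGroup (n : ℕ) : Type := PresentedGroup (braidRels n)

instance (n : ℕ) : Group (BraidGroup n) :=
  inferInstanceAs (Group (PresentedGroup (braidRels n)))

/-- The Artin generator `β_i` of the braid group. -/
def braidGen (n : ℕ) (i : Fin (n - 1)) : BraidGroup n := PresentedGroup.of i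

/-- The `i`-th Hurwitz twist `T_i` on `n`-tuples of elements of a group `G`. -/
def hurwitzTwist {G : Type*} [Group G] {n : ℕ} (i : Fin (n - 1)) (ρ : Fin n → G) :
    Fin n → G := fun k =>
  if (k : ℕ) = (i : ℕ) then
    ρ k * ρ ⟨(i : ℕ) + 1, by have := i.isLt; omega⟩ * (ρ k)⁻¹
  else if (k : ℕ) = (i : ℕ) + 1 then
    ρ ⟨(i : ℕ), by have := i.isLt; omega⟩
  else ρ k

/-- `act` is a right action of `B_n` on `G^n` in which `β_i` acts by the Hurwitz twist `T_i`.
(Such an action exists and is unique.) -/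
def IsHurwitzAction {G : Type*} [Group G] {n : ℕ}
    (act : (Fin n → G) → BraidGroup n → (Fin n → G)) : Prop :=
  (∀ ρ, act ρ 1 = ρ) ∧
  (∀ ρ a b, act ρ (a * b) = act (act ρ a) b) ∧
  (∀ ρ (i : Fin (n - 1)), act ρ (braidGen n i) = hurwitzTwist i ρ)

/-- The ordered product `ρ_0 ρ_1 ⋯ ρ_{n-1}` of the entries of a tuple (boundary monodromy). -/
def tupleProd {G : Type*} [Monoid G] {n : ℕ} (ρ : Fin n → G) : G :=
  (List.ofFn ρ).prod

/-- The standard 3-fold covering `ρ^n(3) = ((1 2),(1 2),(2 3),…,(2 3))`. -/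
def rho3 (n : ℕ) : Fin n → Perm (Fin 3) :=
  fun i => if (i : ℕ) < 2 then Equiv.swap 0 1 else Equiv.swap 1 2

/-- `C^n`: tuples of transpositions of `S_4` with first two entries `(1 2)`, the others in
`{(2 3), (1 4)}`, whose entries generate `S_4`. -/
def Cset (n : ℕ) : Set (Fin n → Perm (Fin 4)) :=
  {ρ | (∀ i : Fin n, (i : ℕ) < 2 → ρ i = Equiv.swap 0 1) ∧
       (∀ i : Fin n, 2 ≤ (i : ℕ) → ρ i = Equiv.swap 1 2 ∨ ρ i = Equiv.swap 0 3) ∧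
       Subgroup.closure (Set.range ρ) = ⊤}

open scoped Classical in
/-- The tuple `ρ_I^n`. -/
noncomputable def rhoI (n : ℕ) (I : Set ℕ) : Fin n → Perm (Fin 4) := fun i =>
  if (i : ℕ) < 2 then Equiv.swap 0 1
  else if (i : ℕ) ∈ I then Equiv.swap 0 3
  else Equiv.swap 1 2

open scoped Classical in
/-- The tuple `ρ̃_I^n`. -/
noncomputable def rhoTilde (n : ℕ) (I : Set ℕ) : Fin n → Perm (Fin 4) := fun i =>
  if (i : ℕ) < 2 then Equiv.swap 0 1
  else if (i : ℕ) ∈ I then Equiv.swap 1 2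
  else Equiv.swap 0 3

/-- The braid `γ = β_3 β_2 β_1² β_2 β_3² β_2 β_1`. -/
def gammaBraid (n : ℕ) (hn : 6 ≤ n) : BraidGroup n :=
  braidGen n ⟨3, by omega⟩ * braidGen n ⟨2, by omega⟩ * (braidGen n ⟨1, by omega⟩) ^ 2 *
    braidGen n ⟨2, by omega⟩ * (braidGen n ⟨3, by omega⟩) ^ 2 * braidGen n ⟨2, by omega⟩ *
    braidGen n ⟨1, by omega⟩

/-- The braid `δ_4 = γ⁻¹ β_4 γ`. -/
def delta4 (n : ℕ) (hn : 6 ≤ n) : BraidGroup n :=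
  (gammaBraid n hn)⁻¹ * braidGen n ⟨4, by omega⟩ * gammaBraid n hn

/-- The braid `η = β_5⁻¹ β_4⁻¹ β_3⁻¹ β_2⁻¹ β_6⁻¹ β_5⁻¹ β_4⁻¹ β_3⁻¹`. -/
def etaBraid (n : ℕ) (hn : 8 ≤ n) : BraidGroup n :=
  (braidGen n ⟨5, by omega⟩)⁻¹ * (braidGen n ⟨4, by omega⟩)⁻¹ * (braidGen n ⟨3, by omega⟩)⁻¹ *
    (braidGen n ⟨2, by omega⟩)⁻¹ * (braidGen n ⟨6, by omega⟩)⁻¹ * (braidGen n ⟨5, by omega⟩)⁻¹ *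
    (braidGen n ⟨4, by omega⟩)⁻¹ * (braidGen n ⟨3, by omega⟩)⁻¹

/-- The braid `δ_6 = η⁻¹ δ_4 η`. -/
def delta6 (n : ℕ) (hn : 8 ≤ n) : BraidGroup n :=
  (etaBraid n hn)⁻¹ * delta4 n (by omega) * etaBraid n hn

/-- The product `β_a β_{a+1} ⋯ β_b` of consecutive Artin generators. -/
def betaChain (n a b : ℕ) (h : b < n - 1) : BraidGroup n :=
  (List.ofFn (fun k : Fin (b + 1 - a) =>
    braidGen n ⟨a + (k : ℕ), by have := k.isLt; omega⟩)).prod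

/-- The elementary `M` move relative to the tuple `ρ`: inserting or deleting `β_i^3` at a
position where the two colors at `i, i+1` are non-commuting (interacting) transpositions. -/
def mMove {α : Type*} [DecidableEq α] {n : ℕ}
    (act : (Fin n → Perm α) → BraidGroup n → (Fin n → Perm α))
    (ρ : Fin n → Perm α) (x y : BraidGroup n) : Prop :=
  ∃ g h : BraidGroup n, ∃ i : Fin (n - 1),
    (act ρ g ⟨(i : ℕ), by have := i.isLt; omega⟩).IsSwap ∧
    (act ρ g ⟨(i : ℕ) + 1, by have := i.isLt; omega⟩).IsSwap ∧
    act ρ g ⟨(i : ℕ), by have := i.isLt; omega⟩ *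
        act ρ g ⟨(i : ℕ) + 1, by have := i.isLt; omega⟩ ≠
      act ρ g ⟨(i : ℕ) + 1, by have := i.isLt; omega⟩ *
        act ρ g ⟨(i : ℕ), by have := i.isLt; omega⟩ ∧
    x = g * braidGen n i ^ 3 * h ∧ y = g * h

/-- The elementary `P` move relative to the tuple `ρ`: inserting or deleting `β_i^2` at a
position where the two colors at `i, i+1` are distinct commuting (disjoint) transpositions. -/
def pMove {α : Type*} [DecidableEq α] {n : ℕ}
    (act : (Fin n → Perm α) → BraidGroup n → (Fin n → Perm α))
    (ρ : Fin n → Perm α) (x y : BraidGroup n) : Prop :=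
  ∃ g h : BraidGroup n, ∃ i : Fin (n - 1),
    (act ρ g ⟨(i : ℕ), by have := i.isLt; omega⟩).IsSwap ∧
    (act ρ g ⟨(i : ℕ) + 1, by have := i.isLt; omega⟩).IsSwap ∧
    act ρ g ⟨(i : ℕ), by have := i.isLt; omega⟩ ≠
      act ρ g ⟨(i : ℕ) + 1, by have := i.isLt; omega⟩ ∧
    act ρ g ⟨(i : ℕ), by have := i.isLt; omega⟩ *
        act ρ g ⟨(i : ℕ) + 1, by have := i.isLt; omega⟩ =
      act ρ g ⟨(i : ℕ) + 1, by have := i.isLt; omega⟩ *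
        act ρ g ⟨(i : ℕ), by have := i.isLt; omega⟩ ∧
    x = g * braidGen n i ^ 2 * h ∧ y = g * h

/-- MP-equivalence relative to `ρ`: the equivalence relation on `B_n` generated by the
`M` and `P` moves. -/
def mpEquiv {α : Type*} [DecidableEq α] {n : ℕ}
    (act : (Fin n → Perm α) → BraidGroup n → (Fin n → Perm α))
    (ρ : Fin n → Perm α) : BraidGroup n → BraidGroup n → Prop :=
  Relation.EqvGen (fun x y => mMove act ρ x y ∨ pMove act ρ x y)

/-- `N(ρ)`: the set of braids MP-equivalent to the identity relative to `ρ`. -/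
def Nset {α : Type*} [DecidableEq α] {n : ℕ}
    (act : (Fin n → Perm α) → BraidGroup n → (Fin n → Perm α))
    (ρ : Fin n → Perm α) : Set (BraidGroup n) :=
  {b | mpEquiv act ρ b 1}

theorem braidGen_comm {n : ℕ} (i j : Fin (n - 1)) (h : (i : ℕ) + 2 ≤ j) :
    Commute (braidGen n i) (braidGen n j) := by
  have hr : (PresentedGroup.mk (braidRels n)) (FreeGroup.of i * FreeGroup.of j *
      (FreeGroup.of i)⁻¹ * (FreeGroup.of j)⁻¹) = 1 :=
    PresentedGroup.one_of_mem (Or.inl ⟨i, j, h, rfl⟩)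
  simp only [map_mul, map_inv] at hr
  exact (commutatorElement_eq_one_iff_commute).1 hr

theorem braidGen_braid {n : ℕ} (i j : Fin (n - 1)) (h : (i : ℕ) + 1 = j) :
    braidGen n i * braidGen n j * braidGen n i = braidGen n j * braidGen n i * braidGen n j := by
  have hr : (PresentedGroup.mk (braidRels n)) (FreeGroup.of i * FreeGroup.of j * FreeGroup.of i *
      (FreeGroup.of j * FreeGroup.of i * FreeGroup.of j)⁻¹) = 1 :=
    PresentedGroup.one_of_mem (Or.inr ⟨i, j, h, rfl⟩)
  simp only [map_mul, map_inv] at hr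
  exact mul_inv_eq_one.1 hr

/-- The double strand `b a² b` satisfies the four-term (type `B`) braid relation with `c`. -/
theorem braid_typeB {G : Type*} [Group G] {a b c : G} (hab : a * b * a = b * a * b)
    (hbc : b * c * b = c * b * c) (hac : Commute a c) :
    (b * a ^ 2 * b) * c * (b * a ^ 2 * b) * c = c * (b * a ^ 2 * b) * c * (b * a ^ 2 * b) := by
  have hb : Commute b (c * b * a ^ 2 * b * c) :=
    calc b * (c * b * a ^ 2 * b * c) = (b * c * b) * a ^ 2 * b * c := by simp only [mul_assoc]
      _ = c * b * (c * a ^ 2) * b * c := by rw [hbc]; simp only [mul_assoc]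
      _ = c * b * a ^ 2 * (c * b * c) := by
        rw [← (hac.pow_left 2).eq]; simp only [mul_assoc]
      _ = c * b * a ^ 2 * b * c * b := by rw [← hbc]; simp only [mul_assoc]
  have ha : Commute a (c * b * a ^ 2 * b * c) :=
    calc a * (c * b * a ^ 2 * b * c) = a * c * b * a ^ 2 * b * c := by simp only [mul_assoc]
      _ = c * (a * b * a) * a * b * c := by rw [hac.eq, pow_two]; simp only [mul_assoc]
      _ = c * b * a * (b * a * b) * c := by rw [hab]; simp only [mul_assoc]
      _ = c * b * a * a * b * (a * c) := by rw [← hab]; simp only [mul_assoc]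
      _ = c * b * a ^ 2 * b * c * a := by rw [hac.eq, pow_two]; simp only [mul_assoc]
  have h := ((hb.mul_left (ha.pow_left 2)).mul_left hb).eq
  simpa only [mul_assoc] using h

theorem hurwitzAction_inv {G : Type*} [Group G] {n : ℕ}
    {act : (Fin n → G) → BraidGroup n → (Fin n → G)} (hact : IsHurwitzAction act)
    {ρ σ : Fin n → G} {g : BraidGroup n} (hg : act ρ g = σ) : act σ g⁻¹ = ρ := by
  rw [← hg, ← hact.2.1, mul_inv_cancel, hact.1]

/-- `M`-equivalence of braids relative to the tuple `ρ`. -/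
abbrev mEquiv {α : Type*} [DecidableEq α] {n : ℕ}
    (act : (Fin n → Perm α) → BraidGroup n → (Fin n → Perm α))
    (ρ : Fin n → Perm α) : BraidGroup n → BraidGroup n → Prop :=
  Relation.EqvGen (mMove act ρ)

section MEquiv

variable {α : Type*} [DecidableEq α] {n : ℕ}
  {act : (Fin n → Perm α) → BraidGroup n → (Fin n → Perm α)} {ρ σ : Fin n → Perm α}
  {g x y : BraidGroup n}

theorem mEquiv_mul_right (h : mEquiv act ρ x y) (z : BraidGroup n) :
    mEquiv act ρ (x * z) (y * z) := by
  induction h with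
  | rel x y h =>
    obtain ⟨g, h, i, h₁, h₂, h₃, rfl, rfl⟩ := h
    exact .rel _ _ ⟨g, h * z, i, h₁, h₂, h₃, mul_assoc _ _ _, mul_assoc _ _ _⟩
  | refl x => exact .refl _
  | symm x y _ ih => exact .symm _ _ ih
  | trans x y z _ _ ih₁ ih₂ => exact .trans _ _ _ ih₁ ih₂

theorem mEquiv_mul_left (hact : IsHurwitzAction act) (hg : act ρ g = σ)
    (h : mEquiv act σ x y) : mEquiv act ρ (g * x) (g * y) := by
  induction h with
  | rel x y h =>
    obtain ⟨k, h, i, h₁, h₂, h₃, rfl, rfl⟩ := h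
    have e : act ρ (g * k) = act σ k := by rw [hact.2.1, hg]
    exact .rel _ _ ⟨g * k, h, i, e ▸ h₁, e ▸ h₂, e ▸ h₃, by simp only [mul_assoc],
      (mul_assoc _ _ _).symm⟩
  | refl x => exact .refl _
  | symm x y _ ih => exact .symm _ _ ih
  | trans x y z _ _ ih₁ ih₂ => exact .trans _ _ _ ih₁ ih₂

theorem mEquiv_mul_mul (hact : IsHurwitzAction act) (hg : act ρ g = σ)
    (h : mEquiv act σ x y) (z : BraidGroup n) : mEquiv act ρ (g * x * z) (g * y * z) :=
  mEquiv_mul_right (mEquiv_mul_left hact hg h) z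

/-- The two transpositions at positions `i` and `i + 1` do not commute. -/
def Interacts (ρ : Fin n → Perm α) (i : Fin (n - 1)) : Prop :=
  (ρ ⟨i, by omega⟩).IsSwap ∧ (ρ ⟨(i : ℕ) + 1, by omega⟩).IsSwap ∧
    ρ ⟨i, by omega⟩ * ρ ⟨(i : ℕ) + 1, by omega⟩ ≠ ρ ⟨(i : ℕ) + 1, by omega⟩ * ρ ⟨i, by omega⟩

theorem mEquiv_cube_mul (hact : IsHurwitzAction act) {i : Fin (n - 1)} (hi : Interacts ρ i)
    (z : BraidGroup n) : mEquiv act ρ (braidGen n i ^ 3 * z) z := by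
  refine .rel _ _ ⟨1, z, i, ?_, ?_, ?_, by rw [one_mul], (one_mul z).symm⟩ <;> rw [hact.1]
  exacts [hi.1, hi.2.1, hi.2.2]

theorem mEquiv_sq (hact : IsHurwitzAction act) {i : Fin (n - 1)} (hi : Interacts ρ i) :
    mEquiv act ρ (braidGen n i ^ 2) (braidGen n i)⁻¹ := by
  have h := mEquiv_cube_mul hact hi (braidGen n i)⁻¹
  rwa [pow_succ, mul_inv_cancel_right] at h

theorem mEquiv_inv_sq (hact : IsHurwitzAction act) {i : Fin (n - 1)} (hi : Interacts ρ i) :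
    mEquiv act ρ (braidGen n i ^ 2)⁻¹ (braidGen n i) := by
  have h := mEquiv_cube_mul hact hi (braidGen n i ^ 2)⁻¹
  rw [pow_succ', mul_inv_cancel_right] at h
  exact .symm _ _ h

/-- If the tuple `ρ` carries the pattern `x, x, y` of non-commuting transpositions at positions
`i, j, j + 1`, then the square of the double strand `β_j β_i² β_j` is `M`-equivalent
to `β_i⁻¹`. -/
theorem mEquiv_double_strand_sq (hact : IsHurwitzAction act) {i j : Fin (n - 1)}
    (hij : (i : ℕ) + 1 = j) {ρ₁ ρ₂ ρ₃ : Fin n → Perm α} (h₁ : act ρ (braidGen n j) = ρ₁)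
    (h₂ : act ρ₂ (braidGen n i) = ρ₁) (h₃ : act ρ₃ (braidGen n j) = ρ₂)
    (hi₁ : Interacts ρ₁ i) (hj₂ : Interacts ρ₂ j) (hi₃ : Interacts ρ₃ i) :
    mEquiv act ρ ((braidGen n j * braidGen n i ^ 2 * braidGen n j) ^ 2) (braidGen n i)⁻¹ := by
  have hb := braidGen_braid i j hij
  set a := braidGen n i
  set b := braidGen n j
  have e₂ : act ρ (b * a⁻¹) = ρ₂ := by rw [hact.2.1, h₁, hurwitzAction_inv hact h₂]
  have e₃ : act ρ (b * a⁻¹ * b⁻¹) = ρ₃ := by rw [hact.2.1, e₂, hurwitzAction_inv hact h₃]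
  have s₁ := mEquiv_mul_mul hact h₁ (mEquiv_sq hact hi₁) (b ^ 2 * a ^ 2 * b)
  have s₂ := mEquiv_mul_mul hact e₂ (mEquiv_sq hact hj₂) (a ^ 2 * b)
  have s₃ := mEquiv_mul_mul hact e₃ (mEquiv_sq hact hi₃) b
  have f₁ : (b * a ^ 2 * b) ^ 2 = b * a ^ 2 * (b ^ 2 * a ^ 2 * b) := by
    simp only [pow_two, mul_assoc]
  have f₂ : b * a⁻¹ * (b ^ 2 * a ^ 2 * b) = b * a⁻¹ * b ^ 2 * (a ^ 2 * b) := by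
    simp only [mul_assoc]
  have f₃ : b * a⁻¹ * b⁻¹ * (a ^ 2 * b) = b * a⁻¹ * b⁻¹ * a ^ 2 * b := by
    simp only [mul_assoc]
  have f₄ : b * a⁻¹ * b⁻¹ * a⁻¹ * b = a⁻¹ := by
    have : a⁻¹ * b⁻¹ * a⁻¹ = b⁻¹ * a⁻¹ * b⁻¹ := by
      simpa only [mul_inv_rev, mul_assoc] using congrArg (·⁻¹) hb
    calc b * a⁻¹ * b⁻¹ * a⁻¹ * b = b * (a⁻¹ * b⁻¹ * a⁻¹) * b := by simp only [mul_assoc]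
      _ = a⁻¹ := by rw [this]; group
  rw [f₁]
  refine .trans _ _ _ s₁ ?_
  rw [f₂]
  refine .trans _ _ _ s₂ ?_
  rw [f₃]
  rwa [f₄] at s₃

/-- If the square of `x` is `M`-equivalent to a braid `z⁻¹` with `z` commuting with `c`, and `x`
and `c` satisfy the four-term braid relation, then `x⁻¹ c x` and `c` commute up to
`M`-equivalence. -/
theorem mEquiv_conj_comm (hact : IsHurwitzAction act) {c z : BraidGroup n} (hc : act ρ c = ρ)
    (hx : act ρ (x ^ 2) = ρ) (hxc : x * c * x * c = c * x * c * x) (hzc : Commute z c)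
    (hxz : mEquiv act ρ (x ^ 2) z⁻¹) :
    mEquiv act ρ (x⁻¹ * c * x * c) (c * (x⁻¹ * c * x)) := by
  have hx' : act ρ (x ^ 2)⁻¹ = ρ := hurwitzAction_inv hact hx
  have h : mEquiv act ρ (x ^ 2)⁻¹ z := by
    have := mEquiv_mul_mul hact hx' hxz z
    rw [inv_mul_cancel, one_mul, inv_mul_cancel_right] at this
    exact .symm _ _ this
  have f₁ : x⁻¹ * c * x * c = (x ^ 2)⁻¹ * (c * x * c * x) := by rw [← hxc, pow_two]; group
  have f₂ : z * (c * x * c * x) = c * z * (x * c * x) := by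
    rw [← hzc.eq]; simp only [mul_assoc]
  have f₃ : c * (x⁻¹ * c * x) = c * (x ^ 2)⁻¹ * (x * c * x) := by rw [pow_two]; group
  rw [f₁, f₃]
  refine .trans _ _ _ (mEquiv_mul_right h _) ?_
  rw [f₂]
  exact .symm _ _ (mEquiv_mul_mul hact hc h _)

end MEquiv

instance {α : Type*} [DecidableEq α] [Fintype α] (f : Perm α) : Decidable f.IsSwap :=
  inferInstanceAs (Decidable (∃ x y, x ≠ y ∧ f = swap x y))

instance {α : Type*} [DecidableEq α] [Fintype α] {n : ℕ} (ρ : Fin n → Perm α)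
    (i : Fin (n - 1)) : Decidable (Interacts ρ i) :=
  inferInstanceAs (Decidable (_ ∧ _ ∧ _))

/-- Lemma: in `B_6`, `δ_4` commutes with `β_4` modulo the move `M`, relative to the
standard 3-fold covering `ρ^6(3)`. -/
theorem stmt7
    (act : (Fin 6 → Perm (Fin 3)) → BraidGroup 6 → (Fin 6 → Perm (Fin 3)))
    (hact : IsHurwitzAction act) :
    Relation.EqvGen (mMove act (rho3 6))
      (delta4 6 (by omega) * braidGen 6 ⟨4, by omega⟩)
      (braidGen 6 ⟨4, by omega⟩ * delta4 6 (by omega)) := by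
  have b12 := braidGen_braid (n := 6) 1 2 rfl
  have b23 := braidGen_braid (n := 6) 2 3 rfl
  have b34 := braidGen_braid (n := 6) 3 4 rfl
  have c13 := braidGen_comm (n := 6) 1 3 (by decide)
  have c14 := braidGen_comm (n := 6) 1 4 (by decide)
  have c24 := braidGen_comm (n := 6) 2 4 (by decide)
  let τ : Fin 6 → Perm (Fin 3) :=
    ![swap 0 1, swap 1 2, swap 1 2, swap 0 1, swap 1 2, swap 1 2]
  let τ' : Fin 6 → Perm (Fin 3) :=
    ![swap 0 1, swap 1 2, swap 1 2, swap 0 2, swap 0 1, swap 1 2]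
  let κ : Fin 6 → Perm (Fin 3) :=
    ![swap 0 1, swap 1 2, swap 1 2, swap 0 2, swap 0 2, swap 0 1]
  let κ' : Fin 6 → Perm (Fin 3) :=
    ![swap 0 1, swap 0 1, swap 0 1, swap 0 2, swap 0 2, swap 0 1]
  let κ₁ : Fin 6 → Perm (Fin 3) :=
    ![swap 0 1, swap 1 2, swap 0 1, swap 1 2, swap 0 2, swap 0 1]
  let κ₂ : Fin 6 → Perm (Fin 3) :=
    ![swap 0 1, swap 0 1, swap 0 2, swap 1 2, swap 0 2, swap 0 1]
  let κ₃ : Fin 6 → Perm (Fin 3) :=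
    ![swap 0 1, swap 0 1, swap 1 2, swap 0 1, swap 0 2, swap 0 1]
  have aρ : act (rho3 6) (braidGen 6 2 * braidGen 6 1)⁻¹ = τ := by
    apply hurwitzAction_inv hact
    rw [hact.2.1, hact.2.2, hact.2.2]
    decide
  have aτ : act τ (braidGen 6 4) = τ := by rw [hact.2.2]; decide
  have aτ' : act τ (braidGen 6 3) = τ' := by rw [hact.2.2]; decide
  have aκ : act τ' (braidGen 6 4) = κ := by rw [hact.2.2]; decide
  have aκ3 : act κ (braidGen 6 3) = κ := by rw [hact.2.2]; decide
  have aκ3' : act κ' (braidGen 6 3) = κ' := by rw [hact.2.2]; decide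
  have aκ₁ : act κ (braidGen 6 2) = κ₁ := by rw [hact.2.2]; decide
  have aκ₂ : act κ₂ (braidGen 6 1) = κ₁ := by rw [hact.2.2]; decide
  have aκ₃ : act κ₃ (braidGen 6 2) = κ₂ := by rw [hact.2.2]; decide
  have aA : act κ (braidGen 6 2 * braidGen 6 1 ^ 2 * braidGen 6 2) = κ' := by
    rw [pow_two]; simp only [hact.2.1, hact.2.2]; decide
  have aA' : act κ' (braidGen 6 2 * braidGen 6 1 ^ 2 * braidGen 6 2) = κ := by
    rw [pow_two]; simp only [hact.2.1, hact.2.2]; decide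
  have core := mEquiv_conj_comm hact aκ3 (by rw [pow_two, hact.2.1, aA, aA'])
    (braid_typeB b12 b23 c13) c13
    (mEquiv_double_strand_sq hact rfl aκ₁ aκ₂ aκ₃ (by decide) (by decide) (by decide))
  have q₁ := mEquiv_inv_sq hact (ρ := τ) (i := 3) (by decide)
  have q₂ := mEquiv_sq hact (ρ := τ') (i := 3) (by decide)
  have d₁ : delta4 6 (by omega) = (braidGen 6 3 * braidGen 6 2 * braidGen 6 1 ^ 2 *
      braidGen 6 2 * braidGen 6 3 ^ 2 * braidGen 6 2 * braidGen 6 1)⁻¹ * braidGen 6 4 *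
      (braidGen 6 3 * braidGen 6 2 * braidGen 6 1 ^ 2 *
      braidGen 6 2 * braidGen 6 3 ^ 2 * braidGen 6 2 * braidGen 6 1) := rfl
  rw [d₁]
  change mEquiv act (rho3 6) (_ * braidGen 6 4) (braidGen 6 4 * _)
  clear_value τ τ' κ κ' κ₁ κ₂ κ₃
  have hdu : Commute (braidGen 6 2 * braidGen 6 1) (braidGen 6 4) := c24.mul_left c14
  have hdA : Commute (braidGen 6 2 * braidGen 6 1 ^ 2 * braidGen 6 2) (braidGen 6 4) :=
    (c24.mul_left (c14.pow_left 2)).mul_left c24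
  have f₀ : braidGen 6 3 * braidGen 6 2 * braidGen 6 1 ^ 2 * braidGen 6 2 * braidGen 6 3 ^ 2 *
      braidGen 6 2 * braidGen 6 1 = braidGen 6 3 * (braidGen 6 2 * braidGen 6 1 ^ 2 *
      braidGen 6 2) * braidGen 6 3 ^ 2 * (braidGen 6 2 * braidGen 6 1) := by
    simp only [mul_assoc]
  rw [f₀]
  set A := braidGen 6 2 * braidGen 6 1 ^ 2 * braidGen 6 2
  set u := braidGen 6 2 * braidGen 6 1
  set c := braidGen 6 3
  set d := braidGen 6 4
  clear_value A u c d
  have b34' : c⁻¹ * d * c = d * c * d⁻¹ := by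
    rw [eq_mul_inv_iff_mul_eq, mul_assoc, mul_assoc, inv_mul_eq_iff_eq_mul]
    simpa only [mul_assoc] using b34.symm
  have hA : A⁻¹ * (d * c * d⁻¹) * A = d * (A⁻¹ * c * A) * d⁻¹ := by
    calc A⁻¹ * (d * c * d⁻¹) * A = (A⁻¹ * d) * c * (d⁻¹ * A) := by simp only [mul_assoc]
      _ = d * (A⁻¹ * c * A) * d⁻¹ := by
        rw [hdA.inv_left.eq, ← hdA.inv_right.eq]; simp only [mul_assoc]
  have aw : act τ (c * d) = κ := by rw [hact.2.1, aτ', aκ]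
  have aK : act κ (A⁻¹ * c * A) = κ := by
    rw [hact.2.1, hact.2.1, hurwitzAction_inv hact aA', aκ3', aA']
  have aE : act τ (c * d * (A⁻¹ * c * A) * d⁻¹) = τ' := by
    rw [hact.2.1, hact.2.1, aw, aK, hurwitzAction_inv hact aκ]
  have step : mEquiv act τ ((c * A * c ^ 2)⁻¹ * d * (c * A * c ^ 2))
      (c * d * (A⁻¹ * c * A) * (c * d)⁻¹) := by
    have g₁ : (c * A * c ^ 2)⁻¹ * d * (c * A * c ^ 2) =
        (c ^ 2)⁻¹ * (A⁻¹ * (c⁻¹ * d * c) * A * c ^ 2) := by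
      simp only [mul_inv_rev, mul_assoc]
    have g₂ : c * (d * (A⁻¹ * c * A) * d⁻¹ * c ^ 2) =
        c * d * (A⁻¹ * c * A) * d⁻¹ * c ^ 2 := by simp only [mul_assoc]
    have g₃ : c * d * (A⁻¹ * c * A) * (c * d)⁻¹ =
        c * d * (A⁻¹ * c * A) * d⁻¹ * c⁻¹ := by simp only [mul_inv_rev, mul_assoc]
    rw [g₁, b34', hA, g₃]
    refine .trans _ _ _ (mEquiv_mul_right q₁ _) ?_
    rw [g₂]
    exact mEquiv_mul_left hact aE q₂
  have hcd : c * d * c = d * (c * d) := by rw [b34]; simp only [mul_assoc]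
  have hcd' : (c * d)⁻¹ * d = c * (c * d)⁻¹ := by
    rw [inv_mul_eq_iff_eq_mul, ← mul_assoc, eq_mul_inv_iff_mul_eq, hcd]
  have main : mEquiv act τ ((c * A * c ^ 2)⁻¹ * d * (c * A * c ^ 2) * d)
      (d * ((c * A * c ^ 2)⁻¹ * d * (c * A * c ^ 2))) := by
    refine .trans _ _ _ (mEquiv_mul_right step d) (.trans _ _ _ ?_
      (.symm _ _ (mEquiv_mul_left hact aτ step)))
    have g₁ : c * d * (A⁻¹ * c * A) * (c * d)⁻¹ * d =
        c * d * (A⁻¹ * c * A * c) * (c * d)⁻¹ := by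
      rw [mul_assoc, hcd']; simp only [mul_assoc]
    have g₂ : d * (c * d * (A⁻¹ * c * A) * (c * d)⁻¹) =
        c * d * (c * (A⁻¹ * c * A)) * (c * d)⁻¹ := by
      simp only [← mul_assoc]; rw [← b34]
    rw [g₁, g₂]
    exact mEquiv_mul_mul hact aw core _
  have k₁ : (c * A * c ^ 2 * u)⁻¹ * d * (c * A * c ^ 2 * u) * d =
      u⁻¹ * ((c * A * c ^ 2)⁻¹ * d * (c * A * c ^ 2) * d) * u := by
    simp only [mul_inv_rev, mul_assoc, hdu.eq]
  have k₂ : d * ((c * A * c ^ 2 * u)⁻¹ * d * (c * A * c ^ 2 * u)) =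
      u⁻¹ * (d * ((c * A * c ^ 2)⁻¹ * d * (c * A * c ^ 2))) * u := by
    rw [← mul_assoc u⁻¹, hdu.inv_left.eq]; simp only [mul_inv_rev, mul_assoc]
  rw [k₁, k₂]
  exact mEquiv_mul_mul hact aρ main u
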